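/- arXiv:2102.06305 — 3 statements merged into one kernel-verified Lean document; each statement's English description precedes it below -/
import Mathlib

section
/- Let O be a Noetherian integral domain with fraction field K, let Λ be a commutative O-algebra and B a commutative Λ-algebra, and let λ : B → O be an O-algebra homomorphism, with λ_Λ : Λ → O its restriction to Λ. Assume: (i) the O-module Ω_{Λ/O} ⊗_{Λ,λ_Λ} O is free of finite rank d; (ii) the O-module Ω_{B/Λ} ⊗_{B,λ} O is torsion; (iii) the K-vector space (Ω_{B/O} ⊗_{B,λ} O) ⊗_O K has dimension at least d. Then the sequence obtained from the first fundamental exact sequence of Kähler differentials by base change along λ, namely 0 → Ω_{Λ/O} ⊗_{Λ,λ_Λ} O → Ω_{B/O} ⊗_{B,λ} O → Ω_{B/Λ} ⊗_{B,λ} O → 0, is a short exact sequence of O-modules (in particular the first map is injective). -/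
/-!
STATEMENT 0: The first fundamental exact sequence of Kähler differentials,
base changed along an `O`-algebra homomorphism `λ : B → O`, namely
`0 → Ω_{Λ/O} ⊗_{Λ,λ_Λ} O → Ω_{B/O} ⊗_{B,λ} O → Ω_{B/Λ} ⊗_{B,λ} O → 0`,
is a short exact sequence, under the hypotheses:
(i) `Ω_{Λ/O} ⊗_{Λ,λ_Λ} O` is a free `O`-module of finite rank `d`;
(ii) `Ω_{B/Λ} ⊗_{B,λ} O` is a torsion `O`-module;
(iii) `(Ω_{B/O} ⊗_{B,λ} O) ⊗_O K` has `K`-dimension at least `d`,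
where `O` is a Noetherian domain with fraction field `K`.

The algebra homomorphism `λ : B → O` (restricting to `λ_Λ : Λ → O`) is encoded by
the instances `Algebra B O`, `Algebra Λ O` together with the scalar-tower
assumptions; `λ = algebraMap B O` is an `O`-algebra map since
`IsScalarTower O B O` forces `algebraMap B O ∘ algebraMap O B = id`.
-/

open TensorProduct

/-- A linear map from a torsion-free module of finite rank over a domain, whose cokernel is torsion
and whose target has at least the same rank, is injective. -/
theorem LinearMap.injective_of_exact_of_isTorsion {R M N P : Type*} [CommRing R] [IsDomain R]
    [AddCommGroup M] [AddCommGroup N] [AddCommGroup P] [Module R M] [Module R N] [Module R P]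
    [Module.IsTorsionFree R M] [Module.Finite R M] {f : M →ₗ[R] N} {g : N →ₗ[R] P}
    (hfg : Function.Exact f g) (hP : Module.IsTorsion R P)
    (hrank : (Module.finrank R M : Cardinal) ≤ Module.rank R N) :
    Function.Injective f := by
  have hquot : Module.rank R (N ⧸ LinearMap.range f) = 0 := by
    rw [rank_eq_zero_iff]
    intro x
    obtain ⟨y, rfl⟩ := Submodule.Quotient.mk_surjective _ x
    obtain ⟨a, ha⟩ := @hP (g y)
    refine ⟨a, nonZeroDivisors.ne_zero a.2, ?_⟩
    rw [← Submodule.Quotient.mk_smul, Submodule.Quotient.mk_eq_zero]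
    refine (hfg _).1 ?_
    rw [map_smul]
    exact ha
  have hrange : Module.rank R (LinearMap.range f) = Module.rank R N := by
    rw [← rank_quotient_add_rank_of_isDomain (LinearMap.range f), hquot, zero_add]
  rw [← hrange, ← Module.finrank_eq_rank, Nat.cast_le] at hrank
  have hadd := f.lift_rank_range_add_rank_ker
  have hM := Module.rank_lt_aleph0 R M
  have hkerfin : Module.rank R (LinearMap.ker f) < Cardinal.aleph0 :=
    (Submodule.rank_le _).trans_lt hM
  rw [← Module.finrank_eq_rank R M, ← Module.finrank_eq_rank R (LinearMap.range f),
    ← Cardinal.cast_toNat_of_lt_aleph0 hkerfin] at hadd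
  simp only [Cardinal.lift_natCast] at hadd
  norm_cast at hadd
  have hker : Module.rank R (LinearMap.ker f) = 0 := by
    rw [← Cardinal.cast_toNat_of_lt_aleph0 hkerfin, Nat.cast_eq_zero]
    lia
  rw [← LinearMap.ker_eq_bot, Submodule.eq_bot_iff]
  intro x hx
  obtain ⟨a, ha, hax⟩ := rank_eq_zero_iff.1 hker ⟨x, hx⟩
  exact (smul_eq_zero.1 (congrArg Subtype.val hax)).resolve_left ha

theorem stmt0 (O Λ B : Type*) [CommRing O] [IsDomain O] [IsNoetherianRing O]
    [CommRing Λ] [CommRing B]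
    [Algebra O Λ] [Algebra O B] [Algebra Λ B] [IsScalarTower O Λ B]
    [Algebra Λ O] [Algebra B O] [IsScalarTower Λ B O] [IsScalarTower O Λ O]
    [IsScalarTower O B O]
    (d : ℕ)
    -- (i) Ω_{Λ/O} ⊗_{Λ,λ_Λ} O is free of finite rank d over O
    (hfree : Module.Free O (O ⊗[Λ] Ω[Λ⁄O]))
    (hfin : Module.Finite O (O ⊗[Λ] Ω[Λ⁄O]))
    (hrank : Module.finrank O (O ⊗[Λ] Ω[Λ⁄O]) = d)
    -- (ii) Ω_{B/Λ} ⊗_{B,λ} O is a torsion O-module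
    (htors : Module.IsTorsion O (O ⊗[B] Ω[B⁄Λ]))
    -- (iii) (Ω_{B/O} ⊗_{B,λ} O) ⊗_O K has K-dimension at least d
    (hdim : (d : Cardinal) ≤
      Module.rank (FractionRing O) ((FractionRing O) ⊗[O] (O ⊗[B] Ω[B⁄O]))) :
    -- the base-changed fundamental sequence is short exact
    Function.Injective
      ((KaehlerDifferential.mapBaseChange O Λ B).baseChange O ∘ₗ
        (TensorProduct.AlgebraTensorModule.cancelBaseChange Λ B O O
          (Ω[Λ⁄O])).symm.toLinearMap) ∧
    Function.Exact
      ((KaehlerDifferential.mapBaseChange O Λ B).baseChange O ∘ₗ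
        (TensorProduct.AlgebraTensorModule.cancelBaseChange Λ B O O
          (Ω[Λ⁄O])).symm.toLinearMap)
      ((KaehlerDifferential.map O Λ B B).baseChange O) ∧
    Function.Surjective ((KaehlerDifferential.map O Λ B B).baseChange O) := by
  have hsurj : Function.Surjective ((KaehlerDifferential.map O Λ B B).baseChange O) :=
    LinearMap.lTensor_surjective O (KaehlerDifferential.map_surjective O Λ B)
  have hexact : Function.Exact
      ((KaehlerDifferential.mapBaseChange O Λ B).baseChange O ∘ₗ
        (TensorProduct.AlgebraTensorModule.cancelBaseChange Λ B O O
          (Ω[Λ⁄O])).symm.toLinearMap)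
      ((KaehlerDifferential.map O Λ B B).baseChange O) := by
    have h : Function.Exact ((KaehlerDifferential.mapBaseChange O Λ B).baseChange O)
        ((KaehlerDifferential.map O Λ B B).baseChange O) :=
      lTensor_exact O (KaehlerDifferential.exact_mapBaseChange_map O Λ B)
        (KaehlerDifferential.map_surjective O Λ B)
    intro y
    rw [h y, LinearMap.coe_comp, LinearEquiv.coe_coe, EquivLike.range_comp]
  refine ⟨LinearMap.injective_of_exact_of_isTorsion hexact htors ?_, hexact, hsurj⟩
  rw [hrank]
  exact hdim.trans_eq (TensorProduct.isBaseChange O (O ⊗[B] Ω[B⁄O]) (FractionRing O)).rank_eq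
end

section
/- Let R be a commutative ring, I ⊆ R an ideal with I² = 0, G a group, and ρ, ρ' : G → GL₂(R) two group homomorphisms such that det ρ'(g) = det ρ(g) for all g ∈ G and such that for every g the matrix x(g) := ρ'(g)ρ(g)⁻¹ − 1 has entries in I. Let V be the R-submodule of M₂(R) consisting of matrices with trace 0 and all entries in I, regarded as a G-module via the conjugation action g · A = ρ(g) A ρ(g)⁻¹. Then x : G → V is a 1-cocycle, i.e. x lies in Z¹(G, V), and hence defines a class in the group cohomology H¹(G, V). -/
/-!
STATEMENT 3: Let `R` be a commutative ring, `I ⊆ R` an ideal with `I² = 0`,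
`G` a group, and `ρ, ρ' : G → GL₂(R)` two group homomorphisms with
`det ρ'(g) = det ρ(g)` for all `g` and such that every
`x(g) := ρ'(g)ρ(g)⁻¹ − 1` has entries in `I`.  Let `V` be the `R`-submodule of
`M₂(R)` of trace-zero matrices with entries in `I`, a `G`-module via
`g · A = ρ(g) A ρ(g)⁻¹`.  Then `x : G → V` is a 1-cocycle, i.e. `x ∈ Z¹(G, V)`:
`x` takes values in `V` and satisfies `x(gg') = x(g) + g · x(g')`.
-/

theorem Matrix.mul_apply_mem_of_right_mem {l m n R : Type*} [Fintype m] [CommRing R]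
    {I : Ideal R} (A : Matrix l m R) {B : Matrix m n R} (hB : ∀ i j, B i j ∈ I) (i : l) (j : n) :
    (A * B) i j ∈ I :=
  I.sum_mem fun k _ => I.mul_mem_left _ (hB k j)

theorem Matrix.mul_apply_mem_of_left_mem {l m n R : Type*} [Fintype m] [CommRing R]
    {I : Ideal R} {A : Matrix l m R} (hA : ∀ i j, A i j ∈ I) (B : Matrix m n R) (i : l) (j : n) :
    (A * B) i j ∈ I :=
  I.sum_mem fun k _ => I.mul_mem_right _ (hA i k)

theorem Ideal.mul_eq_zero_of_mem_of_sq_eq_bot {R : Type*} [CommRing R] {I : Ideal R}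
    (hI : I ^ 2 = ⊥) {a b : R} (ha : a ∈ I) (hb : b ∈ I) : a * b = 0 := by
  have h : a * b ∈ I ^ 2 := sq I ▸ Ideal.mul_mem_mul ha hb
  rwa [hI, Ideal.mem_bot] at h

theorem Matrix.mul_eq_zero_of_mem_of_sq_eq_bot {l m n R : Type*} [Fintype m] [CommRing R]
    {I : Ideal R} (hI : I ^ 2 = ⊥) {A : Matrix l m R} {B : Matrix m n R}
    (hA : ∀ i j, A i j ∈ I) (hB : ∀ i j, B i j ∈ I) : A * B = 0 := by
  ext i j
  exact Finset.sum_eq_zero fun k _ => Ideal.mul_eq_zero_of_mem_of_sq_eq_bot hI (hA i k) (hB k j)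

theorem Matrix.det_one_add_fin_two_of_sq_eq_bot {R : Type*} [CommRing R] {I : Ideal R}
    (hI : I ^ 2 = ⊥) {A : Matrix (Fin 2) (Fin 2) R} (hA : ∀ i j, A i j ∈ I) :
    (1 + A).det = 1 + A.trace := by
  have h₁ := Ideal.mul_eq_zero_of_mem_of_sq_eq_bot hI (hA 0 0) (hA 1 1)
  have h₂ := Ideal.mul_eq_zero_of_mem_of_sq_eq_bot hI (hA 0 1) (hA 1 0)
  simp only [Matrix.det_fin_two, Matrix.trace_fin_two, Matrix.add_apply, Matrix.one_apply_eq,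
    Matrix.one_apply_ne (zero_ne_one (α := Fin 2)), Matrix.one_apply_ne (one_ne_zero (α := Fin 2))]
  linear_combination h₁ - h₂

theorem stmt3 (R : Type*) [CommRing R] (I : Ideal R) (hI : I ^ 2 = ⊥)
    (G : Type*) [Group G]
    (ρ ρ' : G →* GL (Fin 2) R)
    (hdet : ∀ g : G, (ρ' g : Matrix (Fin 2) (Fin 2) R).det =
      (ρ g : Matrix (Fin 2) (Fin 2) R).det)
    (x : G → Matrix (Fin 2) (Fin 2) R)
    (hx : ∀ g, x g = (ρ' g : Matrix (Fin 2) (Fin 2) R) * ((ρ g)⁻¹ : GL (Fin 2) R) - 1)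
    (hxI : ∀ g, ∀ i j, x g i j ∈ I) :
    -- x takes values in V = {A ∈ M₂(R) | tr A = 0 and all entries of A lie in I}
    (∀ g : G, (x g).trace = 0 ∧ ∀ i j, x g i j ∈ I) ∧
    -- and x is a 1-cocycle for the conjugation action g · A = ρ(g) A ρ(g)⁻¹
    (∀ g g' : G, x (g * g') =
      x g + (ρ g : Matrix (Fin 2) (Fin 2) R) * x g' * ((ρ g)⁻¹ : GL (Fin 2) R)) := by
  have hone : ∀ g, 1 + x g =
      (ρ' g : Matrix (Fin 2) (Fin 2) R) * ((ρ g)⁻¹ : GL (Fin 2) R) := fun g => by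
    rw [hx, add_sub_cancel]
  have hρ' : ∀ g, (ρ' g : Matrix (Fin 2) (Fin 2) R) = (1 + x g) * ρ g := fun g => by
    rw [hone, mul_assoc, Units.inv_mul, mul_one]
  refine ⟨fun g => ⟨?_, hxI g⟩, fun g g' => ?_⟩
  · have h : (1 + x g).det = 1 := by
      rw [hone, Matrix.det_mul, hdet, ← Matrix.det_mul, Units.mul_inv, Matrix.det_one]
    rw [Matrix.det_one_add_fin_two_of_sq_eq_bot hI (hxI g)] at h
    exact left_eq_add.mp h.symm
  · have hmul : x g * ((ρ g : Matrix (Fin 2) (Fin 2) R) * x g' * ((ρ g)⁻¹ : GL (Fin 2) R)) = 0 :=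
      Matrix.mul_eq_zero_of_mem_of_sq_eq_bot hI (hxI g) (Matrix.mul_apply_mem_of_left_mem
        (Matrix.mul_apply_mem_of_right_mem _ (hxI g')) _)
    calc x (g * g')
        = (1 + x g) * ρ g * ((ρ' g' : Matrix (Fin 2) (Fin 2) R) * ((ρ g')⁻¹ : GL (Fin 2) R)) *
            ((ρ g)⁻¹ : GL (Fin 2) R) - 1 := by
          rw [hx, map_mul, map_mul, mul_inv_rev, Units.val_mul, Units.val_mul, hρ' g]
          simp only [mul_assoc]
      _ = (1 + x g) * (ρ g * ((ρ g)⁻¹ : GL (Fin 2) R) +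
            (ρ g : Matrix (Fin 2) (Fin 2) R) * x g' * ((ρ g)⁻¹ : GL (Fin 2) R)) - 1 := by
          rw [← hone]
          noncomm_ring
      _ = _ := by
          rw [Units.mul_inv, mul_add, add_mul _ _ (_ * _), hmul]
          noncomm_ring
end

section
/- Let O be an integral domain, π : A → A' a surjective homomorphism of commutative O-algebras such that A' is torsion-free as an O-module, M an A-module, M' an A'-module (regarded as an A-module via π), and q : M → M' a surjective A-linear map such that the kernel of the induced A'-linear map M ⊗_A A' → M' is a torsion O-module. Then for every A-linear map φ : M → A there exists a unique A'-linear map φ' : M' → A' such that φ' ∘ q = π ∘ φ. -/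
/-!
STATEMENT 15: Let `O` be an integral domain, `π : A → A'` a surjective map of
commutative `O`-algebras with `A'` torsion-free over `O`, `M` an `A`-module,
`M'` an `A'`-module, and `q : M → M'` a surjective `A`-linear map (where `M'`
is an `A`-module via `π`) such that the kernel of the induced `A'`-linear map
`M ⊗_A A' → M'` is `O`-torsion.  Then every `A`-linear `φ : M → A` descends to
a unique `A'`-linear `φ' : M' → A'` with `φ' ∘ q = π ∘ φ`.

Since `q` is surjective, `M ⊗_A A' ≅ M / (ker π)·M`, so the torsion-kernel
hypothesis is encoded as: every `m ∈ M` with `q m = 0` satisfies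
`o • m ∈ (ker π)·M` for some nonzero `o ∈ O`.
-/

theorem stmt15 (O A A' M M' : Type*) [CommRing O] [IsDomain O]
    [CommRing A] [CommRing A'] [Algebra O A] [Algebra O A']
    (π : A →ₐ[O] A') (hπ : Function.Surjective π)
    -- A' is torsion-free as an O-module
    (htf : ∀ (o : O) (a : A'), o • a = 0 → o = 0 ∨ a = 0)
    [AddCommGroup M] [Module A M] [Module O M] [IsScalarTower O A M]
    [AddCommGroup M'] [Module A' M'] [Module O M'] [IsScalarTower O A' M']
    -- q : M → M' is A-linear (M' viewed as A-module via π) and surjective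
    (q : M →+ M')
    (hq : ∀ (a : A) (m : M), q (a • m) = π a • q m)
    (hqsurj : Function.Surjective q)
    -- the kernel of the induced A'-linear map M ⊗[A] A' → M' is O-torsion
    (hker : ∀ m : M, q m = 0 → ∃ o : O, o ≠ 0 ∧
      o • m ∈ (RingHom.ker (π : A →+* A')) • (⊤ : Submodule A M)) :
    ∀ φ : M →ₗ[A] A, ∃! φ' : M' →ₗ[A'] A', ∀ m : M, φ' (q m) = π (φ m) := by
  intro φ
  have hφI : ∀ m ∈ RingHom.ker (π : A →+* A') • (⊤ : Submodule A M), π (φ m) = 0 := by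
    intro m hm
    induction hm using Submodule.smul_induction_on' with
    | smul a ha n _ =>
      have ha' : π a = 0 := ha
      rw [map_smul, smul_eq_mul, map_mul, ha', zero_mul]
    | add x _ y _ hx hy => rw [map_add, map_add, hx, hy, add_zero]
  have hφq : ∀ m, q m = 0 → π (φ m) = 0 := by
    intro m hm
    obtain ⟨o, ho, hom⟩ := hker m hm
    have h := hφI _ hom
    rw [← algebraMap_smul A o m, map_smul, algebraMap_smul, map_smul] at h
    exact (htf o _ h).resolve_left ho
  have hφeq : ∀ m n, q m = q n → π (φ m) = π (φ n) := by
    intro m n h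
    have := hφq (m - n) (by rw [map_sub, h, sub_self])
    rwa [map_sub, map_sub, sub_eq_zero] at this
  choose s hs using hqsurj
  refine ⟨{ toFun := fun x => π (φ (s x)), map_add' := ?_, map_smul' := ?_ }, ?_, ?_⟩
  · intro x y
    rw [← map_add, ← map_add]
    exact hφeq _ _ (by rw [map_add, hs, hs, hs])
  · intro a x
    obtain ⟨b, rfl⟩ := hπ a
    rw [RingHom.id_apply, smul_eq_mul, ← map_mul, ← smul_eq_mul, ← map_smul]
    exact hφeq _ _ (by rw [hq, hs, hs])
  · intro m
    exact hφeq _ _ (hs _)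
  · intro ψ hψ
    ext x
    rw [← hs x, hψ]
    exact hφeq _ _ (hs _).symm
end
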